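/- Let M be a graded D-module over R = k[x_1,…,x_n] such that H^n_dR(M) = M/(∂_1^M(M)+⋯+∂_n^M(M)) is a finite-dimensional k-vector space. Then dim_k H^n_dR(M) equals the greatest integer s ≥ 0 for which there exists a surjective D-linear homomorphism M → E^s, where E^s is the direct sum of s copies of E with componentwise R- and ∂-actions. -/

import Mathlib

/-!
Statement 8: for a graded `D`-module `M` over `R = k[x₁,…,xₙ]` with `H^n_dR(M)`
finite dimensional, `dim_k H^n_dR(M)` is the greatest `s` such that there exists a
surjective `D`-linear map `M → E^s`, where `E = DD(R)` is the graded Matlis dual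
of `R` (isomorphic to the top local cohomology module `H^n_{(x₁,…,xₙ)}(R)`).
-/

open MvPolynomial
open scoped DirectSum

set_option maxHeartbeats 2000000
set_option synthInstance.maxHeartbeats 1000000

section MatlisDual

variable {k : Type} [Field k] {n : ℕ} {M : Type} [AddCommGroup M] [Module k M]

/-- The carrier of the graded Matlis dual `DD(M)`, with `DD(M)_l = Hom_k(M_{-l-n}, k)`. -/
abbrev DDcar (deg : ℤ → Submodule k M) (n : ℕ) : Type :=
  @DirectSum ℤ (fun l => Module.Dual k ↥(deg (-l - (n : ℤ))))
    (fun l => (inferInstance :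
      AddCommGroup (Module.Dual k ↥(deg (-l - (n : ℤ))))).toAddCommMonoid)

/-- Projection of `M` onto its degree-`l` component. -/
noncomputable def gproj (deg : ℤ → Submodule k M) (hint : DirectSum.IsInternal deg) (l : ℤ) :
    M →ₗ[k] ↥(deg l) :=
  (DirectSum.component k ℤ (fun j => ↥(deg j)) l).comp
    (LinearEquiv.ofBijective (DirectSum.coeLinearMap deg) hint).symm.toLinearMap

/-- The evaluation pairing `⟨λ, m⟩ = Σ_l λ_l(m_{-l-n})` between `DD(M)` and `M`
(injective in the first variable, hence characterizing the actions uniquely). -/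
noncomputable def gev (deg : ℤ → Submodule k M) (hint : DirectSum.IsInternal deg) :
    DDcar deg n →ₗ[k] Module.Dual k M :=
  DirectSum.toModule k ℤ (Module.Dual k M)
    (fun l => (gproj deg hint (-l - (n : ℤ))).dualMap)

end MatlisDual

/-- The standard grading of the polynomial ring `R = k[x₁,…,xₙ]`, indexed by `ℤ`. -/
noncomputable def Rdeg (k : Type) [Field k] (n : ℕ) (l : ℤ) :
    Submodule k (MvPolynomial (Fin n) k) :=
  if 0 ≤ l then homogeneousSubmodule (Fin n) k l.toNat else ⊥

/-- The carrier of `E = DD(R)`, the graded Matlis dual of `R`; `E` is isomorphic to the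
top local cohomology module `H^n_{(x₁,…,xₙ)}(R)`, with `E_l = Hom_k(R_{-l-n}, k)`. -/
abbrev Ecar (k : Type) [Field k] (n : ℕ) : Type := DDcar (Rdeg k n) n

section HomogeneousFunctionals

variable {k : Type} [Field k] {n : ℕ} {V : Type} [AddCommGroup V] [Module k V]

/-- A linear map on polynomials that vanishes on all homogeneous polynomials of degree `> d`. -/
def VanishesAbove (d : ℕ) (lam : MvPolynomial (Fin n) k →ₗ[k] V) : Prop :=
  ∀ e, d < e → ∀ g : MvPolynomial (Fin n) k, g.IsHomogeneous e → lam g = 0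

theorem linearMap_ext_of_isHomogeneous {lam mu : MvPolynomial (Fin n) k →ₗ[k] V}
    (h : ∀ e, ∀ g : MvPolynomial (Fin n) k, g.IsHomogeneous e → lam g = mu g) : lam = mu := by
  refine LinearMap.ext fun p => ?_
  rw [← sum_homogeneousComponent p, map_sum, map_sum]
  exact Finset.sum_congr rfl fun e _ => h e _ (homogeneousComponent_isHomogeneous e p)

/-- The transpose of the Euler operator `∑ xᵢ ∂ᵢ`. -/
noncomputable def eulerTranspose (lam : MvPolynomial (Fin n) k →ₗ[k] V) :
    MvPolynomial (Fin n) k →ₗ[k] V :=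
  ∑ i : Fin n, (lam ∘ₗ LinearMap.mulLeft k (X i)) ∘ₗ (pderiv i).toLinearMap

theorem eulerTranspose_apply_of_isHomogeneous (lam : MvPolynomial (Fin n) k →ₗ[k] V) {e : ℕ}
    {g : MvPolynomial (Fin n) k} (hg : g.IsHomogeneous e) :
    eulerTranspose lam g = (e : k) • lam g := by
  have h := congrArg lam hg.sum_X_mul_pderiv
  rw [map_sum, map_nsmul, ← Nat.cast_smul_eq_nsmul k] at h
  simpa [eulerTranspose, LinearMap.sum_apply] using h

theorem VanishesAbove.sub_eulerTranspose [CharZero k] {d : ℕ}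
    {lam : MvPolynomial (Fin n) k →ₗ[k] V} (h : VanishesAbove (d + 1) lam) :
    VanishesAbove d (lam - ((d + 1 : ℕ) : k)⁻¹ • eulerTranspose lam) := by
  intro e he g hg
  rw [LinearMap.sub_apply, LinearMap.smul_apply, eulerTranspose_apply_of_isHomogeneous lam hg]
  rcases eq_or_ne e (d + 1) with rfl | hne
  · have hd : ((d + 1 : ℕ) : k) ≠ 0 := Nat.cast_ne_zero.mpr d.succ_ne_zero
    rw [smul_smul, inv_mul_cancel₀ hd, one_smul, sub_self]
  · rw [h e (by omega) g hg]; simp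

theorem VanishesAbove.eq_of_apply_one_eq {lam mu : MvPolynomial (Fin n) k →ₗ[k] V}
    (hlam : VanishesAbove 0 lam) (hmu : VanishesAbove 0 mu) (h : lam 1 = mu 1) : lam = mu := by
  refine linearMap_ext_of_isHomogeneous fun e g hg => ?_
  rcases Nat.eq_zero_or_pos e with rfl | he
  · rw [← totalDegree_zero_iff_isHomogeneous, totalDegree_eq_zero_iff_eq_C] at hg
    rw [hg, ← mul_one (C _), ← smul_eq_C_mul, map_smul, map_smul, h]
  · rw [hlam e he g hg, hmu e he g hg]

/-- A space of functionals of bounded degree, stable under the transposes of the `xᵢ` and `∂ᵢ`,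
and in which the value at `1` can be prescribed, contains all functionals of bounded degree. -/
theorem mem_of_vanishesAbove [CharZero k]
    (N : Submodule k (MvPolynomial (Fin n) k →ₗ[k] V))
    (hX : ∀ i, ∀ lam ∈ N, lam ∘ₗ LinearMap.mulLeft k (X i) ∈ N)
    (hD : ∀ i, ∀ lam ∈ N, lam ∘ₗ (pderiv i).toLinearMap ∈ N)
    (hbdd : ∀ lam ∈ N, ∃ d, VanishesAbove d lam)
    (hone : ∀ v : V, ∃ lam ∈ N, lam 1 = v) {d : ℕ}
    {lam : MvPolynomial (Fin n) k →ₗ[k] V} (hlam : VanishesAbove d lam) : lam ∈ N := by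
  have socle : ∀ d : ℕ, ∀ mu ∈ N, VanishesAbove d mu →
      ∃ nu ∈ N, VanishesAbove 0 nu ∧ nu 1 = mu 1 := by
    intro d
    induction d with
    | zero => exact fun mu hmu h => ⟨mu, hmu, h, rfl⟩
    | succ d ih =>
      intro mu hmu h
      have hE : eulerTranspose mu ∈ N := sum_mem fun i _ => hD i _ (hX i _ hmu)
      obtain ⟨nu, hnu, h0, h1⟩ := ih _ (sub_mem hmu (N.smul_mem _ hE)) h.sub_eulerTranspose
      refine ⟨nu, hnu, h0, h1.trans ?_⟩
      rw [LinearMap.sub_apply, LinearMap.smul_apply,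
        eulerTranspose_apply_of_isHomogeneous mu (isHomogeneous_one _ _)]
      simp
  induction d generalizing lam with
  | zero =>
    obtain ⟨mu, hmu, h1⟩ := hone (lam 1)
    obtain ⟨d, hd⟩ := hbdd mu hmu
    obtain ⟨nu, hnu, h0, h2⟩ := socle d mu hmu hd
    rwa [hlam.eq_of_apply_one_eq h0 (h1.symm.trans h2.symm)]
  | succ d ih =>
    have hE : eulerTranspose lam ∈ N := by
      refine sum_mem fun i _ => hD i _ (ih fun e he g hg => ?_)
      exact hlam (1 + e) (by omega) _ ((isHomogeneous_X k i).mul hg)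
    simpa using add_mem (ih hlam.sub_eulerTranspose) (N.smul_mem ((d + 1 : ℕ) : k)⁻¹ hE)

end HomogeneousFunctionals

section GradedProjection

variable {k : Type} [Field k] {n : ℕ} {M : Type} [AddCommGroup M] [Module k M]
  {deg : ℤ → Submodule k M} (hint : DirectSum.IsInternal deg)

theorem decompose_eq_lof_of_mem {l : ℤ} {m : M} (hm : m ∈ deg l) :
    (LinearEquiv.ofBijective (DirectSum.coeLinearMap deg) hint).symm m =
      DirectSum.lof k ℤ (fun j => ↥(deg j)) l ⟨m, hm⟩ := by
  rw [LinearEquiv.symm_apply_eq]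
  exact (DirectSum.coeLinearMap_lof deg l ⟨m, hm⟩).symm

theorem gproj_eq_of_mem {l : ℤ} {m : M} (hm : m ∈ deg l) : gproj deg hint l m = ⟨m, hm⟩ := by
  rw [gproj, LinearMap.comp_apply, LinearEquiv.coe_coe, decompose_eq_lof_of_mem hint hm,
    DirectSum.component.lof_self]

theorem gproj_eq_zero_of_mem {l l' : ℤ} (hne : l' ≠ l) {m : M} (hm : m ∈ deg l') :
    gproj deg hint l m = 0 := by
  rw [gproj, LinearMap.comp_apply, LinearEquiv.coe_coe, decompose_eq_lof_of_mem hint hm,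
    DirectSum.component.of, dif_neg hne]

theorem gev_of (l : ℤ) (mu : Module.Dual k ↥(deg (-l - (n : ℤ)))) (m : M) :
    gev deg hint (DirectSum.of (fun l => Module.Dual k ↥(deg (-l - (n : ℤ)))) l mu) m =
      mu (gproj deg hint (-l - (n : ℤ)) m) := by
  rw [gev]
  erw [DirectSum.toModule_lof]
  rfl

theorem gev_apply_of_mem (lam : DDcar deg n) (l : ℤ) {m : M} (hm : m ∈ deg (-l - (n : ℤ))) :
    gev deg hint lam m = lam l ⟨m, hm⟩ := by
  induction lam using DirectSum.induction_on with
  | zero => simp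
  | of l' mu =>
    rw [gev_of]
    rcases eq_or_ne l' l with rfl | hne
    · rw [gproj_eq_of_mem hint hm, DirectSum.of_eq_same]
    · rw [gproj_eq_zero_of_mem hint (by omega) hm, map_zero, DirectSum.of_eq_of_ne _ _ _ hne.symm]
      rfl
  | add a b ha hb =>
    rw [map_add, LinearMap.add_apply, ha, hb]
    rfl

theorem gev_injective : Function.Injective (gev deg hint : DDcar deg n →ₗ[k] Module.Dual k M) := by
  intro a b hab
  refine DFinsupp.ext fun l => LinearMap.ext fun m => ?_
  have h := congrArg (fun f : Module.Dual k M => f m) hab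
  simpa only [gev_apply_of_mem hint _ l m.2] using h

/-- In a graded module whose top de Rham quotient has finite dimension, all elements of large
degree are sums of derivatives. -/
theorem exists_bound_mem_iSup_range {deg : ℤ → Submodule k M}
    (hint : DirectSum.IsInternal deg) {ι : Type} (pd : ι → Module.End k M)
    (hpd : ∀ (i : ι) (l : ℤ), ∀ m ∈ deg l, pd i m ∈ deg (l - 1))
    (hfin : FiniteDimensional k (M ⧸ (⨆ i, LinearMap.range (pd i)))) :
    ∃ B : ℤ, ∀ l, B < l → ∀ m ∈ deg l, m ∈ ⨆ i, LinearMap.range (pd i) := by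
  set W := ⨆ i, LinearMap.range (pd i) with hW
  have htop : iSup deg = ⊤ := hint.submodule_iSup_eq_top
  have hcommute : ∀ l i m, (gproj deg hint l (pd i m) : M) = pd i (gproj deg hint (l + 1) m) := by
    intro l i m
    have hm : m ∈ iSup deg := htop ▸ Submodule.mem_top
    induction hm using Submodule.iSup_induction' with
    | mem j m hm =>
      rcases eq_or_ne j (l + 1) with rfl | hne
      · have h := hpd i _ m hm
        rw [add_sub_cancel_right] at h
        rw [gproj_eq_of_mem hint hm, gproj_eq_of_mem hint h]
      · rw [gproj_eq_zero_of_mem hint hne hm,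
          gproj_eq_zero_of_mem hint (by omega) (hpd i j m hm)]
        simp
    | zero => simp
    | add a b _ _ ha hb => simp only [map_add, Submodule.coe_add, ha, hb]
  have hWproj : ∀ l, W ≤ W.comap ((deg l).subtype ∘ₗ gproj deg hint l) := by
    intro l
    refine iSup_le fun i => ?_
    rintro _ ⟨m, rfl⟩
    change (gproj deg hint l (pd i m) : M) ∈ W
    rw [hcommute]
    exact Submodule.mem_iSup_of_mem i ⟨_, rfl⟩
  let A : ℕ →o Submodule k (M ⧸ W) :=
    { toFun := fun N => ⨆ l : {l : ℤ // l ≤ N}, (deg l).map W.mkQ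
      monotone' := fun a b hab => iSup_le fun l =>
        le_iSup_of_le (ι := {l : ℤ // l ≤ (b : ℤ)}) ⟨l.1, l.2.trans (by exact_mod_cast hab)⟩
          le_rfl }
  obtain ⟨N, hN⟩ := monotone_stabilizes_iff_noetherian.mpr
    (inferInstance : IsNoetherian k (M ⧸ W)) A
  refine ⟨N, fun l hl m hm => ?_⟩
  have hmA : W.mkQ m ∈ A N := by
    rw [hN (max N l.toNat) (le_max_left _ _)]
    refine Submodule.mem_iSup_of_mem (⟨l, ?_⟩ : {j : ℤ // j ≤ ((max N l.toNat : ℕ) : ℤ)})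
      ⟨m, hm, rfl⟩
    push_cast
    exact le_max_of_le_right (Int.self_le_toNat l)
  change W.mkQ m ∈ ⨆ l : {l : ℤ // l ≤ N}, (deg l).map W.mkQ at hmA
  rw [← Submodule.map_iSup] at hmA
  obtain ⟨m', hm', hmm⟩ := hmA
  have hm0 : (gproj deg hint l m' : M) = 0 := by
    have hle : (⨆ j : {j : ℤ // j ≤ N}, deg j) ≤ LinearMap.ker (gproj deg hint l) :=
      iSup_le fun j x hx => gproj_eq_zero_of_mem hint (by have := j.2; omega) hx
    rw [LinearMap.mem_ker.mp (hle hm')]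
    rfl
  have hsub : m - m' ∈ W := by
    rw [← Submodule.Quotient.eq]
    exact hmm.symm
  have := hWproj l hsub
  rwa [Submodule.mem_comap, LinearMap.comp_apply, map_sub, map_sub, Submodule.subtype_apply,
    Submodule.subtype_apply, hm0, gproj_eq_of_mem hint hm, sub_zero] at this

end GradedProjection

section PolynomialDual

variable {k : Type} [Field k] {n : ℕ} (hR : DirectSum.IsInternal (Rdeg k n))

theorem mem_Rdeg_of_isHomogeneous {e : ℕ} {g : MvPolynomial (Fin n) k} (hg : g.IsHomogeneous e) :
    g ∈ Rdeg k n e := by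
  rw [Rdeg, if_pos (Int.natCast_nonneg e), Int.toNat_natCast]
  exact hg

/-- Functionals of bounded degree are represented by the graded Matlis dual. -/
theorem exists_gev_eq_of_vanishesAbove {d : ℕ} {mu : Module.Dual k (MvPolynomial (Fin n) k)}
    (hmu : VanishesAbove d mu) : ∃ lam : Ecar k n, gev (Rdeg k n) hR lam = mu := by
  refine ⟨∑ e ∈ Finset.range (d + 1),
    DirectSum.of (fun l => Module.Dual k ↥(Rdeg k n (-l - (n : ℤ)))) (-(e : ℤ) - n)
      (mu.domRestrict (Rdeg k n (-(-(e : ℤ) - n) - n))), ?_⟩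
  refine linearMap_ext_of_isHomogeneous fun c g hg => ?_
  have hgc := mem_Rdeg_of_isHomogeneous hg
  rw [map_sum, LinearMap.sum_apply]
  simp only [gev_of, LinearMap.domRestrict_apply]
  have hzero : ∀ e : ℕ, e ≠ c → mu (gproj (Rdeg k n) hR (-(-(e : ℤ) - n) - n) g) = 0 := by
    intro e he
    rw [gproj_eq_zero_of_mem hR (by omega) hgc]
    simp
  rcases Nat.lt_or_ge d c with hc | hc
  · rw [hmu c hc g hg]
    refine Finset.sum_eq_zero fun e he => hzero e ?_
    rw [Finset.mem_range] at he
    omega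
  · rw [Finset.sum_eq_single c (fun e _ he => hzero e he)
      (fun h => absurd (Finset.mem_range.mpr (by omega)) h)]
    rw [gproj_eq_of_mem hR (l := -(-(c : ℤ) - n) - n)
      (by rwa [show -(-(c : ℤ) - n) - n = c by ring])]

theorem exists_vanishesAbove_gev (lam : Ecar k n) :
    ∃ d, VanishesAbove d (gev (Rdeg k n) hR lam) := by
  induction lam using DirectSum.induction_on with
  | zero => exact ⟨0, fun e _ g _ => by simp⟩
  | of l mu =>
    refine ⟨(-l - (n : ℤ)).toNat, fun e he g hg => ?_⟩
    rw [gev_of, gproj_eq_zero_of_mem hR (by omega) (mem_Rdeg_of_isHomogeneous hg), map_zero]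
  | add a b ha hb =>
    obtain ⟨d, hd⟩ := ha
    obtain ⟨d', hd'⟩ := hb
    refine ⟨max d d', fun e he g hg => ?_⟩
    rw [map_add, LinearMap.add_apply, hd e (by omega) g hg, hd' e (by omega) g hg, add_zero]

end PolynomialDual

/-- Let `M` be a graded `D`-module over `R = k[x₁,…,xₙ]`
(`char k = 0`, `n ≥ 1`) such that `H^n_dR(M) = M/(∂₁(M)+⋯+∂ₙ(M))` is a finite
dimensional `k`-space.  Let `E = DD(R)` carry its `R`-action `ρE` (characterized by
`⟨f·λ, g⟩ = ⟨λ, f·g⟩`) and `∂`-actions `Epd` (characterized by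
`⟨∂_i·λ, g⟩ = -⟨λ, ∂g/∂x_i⟩`).  Then `dim_k H^n_dR(M)` is the greatest `s ≥ 0` for
which there exists a surjective `D`-linear map `M → E^s` (`E^s` carrying the
componentwise actions). -/
theorem dim_Hn_eq_greatest_rank_of_surjective_Dlinear_map_onto_E_power
    {k : Type} [Field k] [CharZero k] {n : ℕ} (hn : 0 < n)
    {M : Type} [AddCommGroup M] [Module k M]
    [Module (MvPolynomial (Fin n) k) M] [IsScalarTower k (MvPolynomial (Fin n) k) M]
    (pd : Fin n → Module.End k M)
    (hcomm : ∀ i j, Commute (pd i) (pd j))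
    (hleib : ∀ (i : Fin n) (f : MvPolynomial (Fin n) k) (m : M),
      pd i (f • m) = (pderiv i f) • m + f • (pd i m))
    (deg : ℤ → Submodule k M)
    (hint : DirectSum.IsInternal deg)
    (hsmul : ∀ (d : ℕ) (f : MvPolynomial (Fin n) k), f.IsHomogeneous d →
      ∀ (l : ℤ), ∀ m ∈ deg l, f • m ∈ deg (l + d))
    (hpd : ∀ (i : Fin n) (l : ℤ), ∀ m ∈ deg l, pd i m ∈ deg (l - 1))
    (hR : DirectSum.IsInternal (Rdeg k n))
    (ρE : MvPolynomial (Fin n) k →ₐ[k] Module.End k (Ecar k n))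
    (hρE : ∀ (f : MvPolynomial (Fin n) k) (lam : Ecar k n) (g : MvPolynomial (Fin n) k),
      gev (Rdeg k n) hR (ρE f lam) g = gev (Rdeg k n) hR lam (f * g))
    (Epd : Fin n → Module.End k (Ecar k n))
    (hEpd : ∀ (i : Fin n) (lam : Ecar k n) (g : MvPolynomial (Fin n) k),
      gev (Rdeg k n) hR (Epd i lam) g = - gev (Rdeg k n) hR lam (pderiv i g))
    (hfin : FiniteDimensional k (M ⧸ (⨆ i : Fin n, LinearMap.range (pd i)))) :
    IsGreatest
      {s : ℕ | ∃ φ : M →ₗ[k] (Fin s → Ecar k n),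
        Function.Surjective φ ∧
        (∀ (f : MvPolynomial (Fin n) k) (m : M) (j : Fin s),
          φ (f • m) j = ρE f (φ m j)) ∧
        (∀ (i : Fin n) (m : M) (j : Fin s), φ (pd i m) j = Epd i (φ m j))}
      (Module.finrank k (M ⧸ (⨆ i : Fin n, LinearMap.range (pd i)))) := by
  set W := ⨆ i : Fin n, LinearMap.range (pd i) with hW
  have hpdW : ∀ i m, W.mkQ (pd i m) = 0 := fun i m =>
    (Submodule.Quotient.mk_eq_zero W).mpr (Submodule.mem_iSup_of_mem i ⟨m, rfl⟩)
  constructor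
  · let Φ : M →ₗ[k] MvPolynomial (Fin n) k →ₗ[k] M ⧸ W :=
      (Algebra.lsmul k k M).toLinearMap.flip.compr₂ W.mkQ
    have hΦ : ∀ m g, Φ m g = W.mkQ (g • m) := fun _ _ => rfl
    have hΦbdd : ∀ m, ∃ d, VanishesAbove d (Φ m) := by
      obtain ⟨B, hB⟩ := exists_bound_mem_iSup_range hint pd hpd hfin
      intro m
      have hm : m ∈ iSup deg := hint.submodule_iSup_eq_top ▸ Submodule.mem_top
      induction hm using Submodule.iSup_induction' with
      | mem l m hm =>
        refine ⟨(B - l).toNat, fun e he g hg => ?_⟩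
        exact (Submodule.Quotient.mk_eq_zero W).mpr (hB _ (by omega) _ (hsmul e g hg l m hm))
      | zero => exact ⟨0, fun e _ g _ => by simp⟩
      | add a b _ _ ha hb =>
        obtain ⟨d, hd⟩ := ha
        obtain ⟨d', hd'⟩ := hb
        refine ⟨max d d', fun e he g hg => ?_⟩
        rw [map_add, LinearMap.add_apply, hd e (by omega) g hg, hd' e (by omega) g hg, add_zero]
    have hΦD : ∀ i m g, Φ (pd i m) g = - Φ m (pderiv i g) := by
      intro i m g
      have h := congrArg W.mkQ (hleib i g m)
      rw [hpdW, map_add] at h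
      rw [hΦ, hΦ]
      exact eq_neg_of_add_eq_zero_right h.symm
    have hΦsurj : ∀ d (lam : MvPolynomial (Fin n) k →ₗ[k] M ⧸ W), VanishesAbove d lam →
        ∃ m, Φ m = lam := by
      intro d lam hlam
      refine mem_of_vanishesAbove (LinearMap.range Φ) ?_ ?_ ?_ ?_ hlam
      · rintro i _ ⟨m, rfl⟩
        refine ⟨(X i : MvPolynomial (Fin n) k) • m, LinearMap.ext fun g => ?_⟩
        simp [hΦ, smul_smul, mul_comm]
      · rintro i _ ⟨m, rfl⟩
        refine ⟨-pd i m, LinearMap.ext fun g => ?_⟩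
        rw [map_neg, LinearMap.neg_apply, hΦD, neg_neg]
        rfl
      · rintro _ ⟨m, rfl⟩
        exact hΦbdd m
      · intro v
        obtain ⟨m, rfl⟩ := W.mkQ_surjective v
        exact ⟨Φ m, ⟨m, rfl⟩, by rw [hΦ, one_smul]⟩
    let e := (Module.finBasis k (M ⧸ W)).equivFun
    let G := LinearEquiv.ofInjective (gev (n := n) (Rdeg k n) hR) (gev_injective hR)
    let Θ : Fin (Module.finrank k (M ⧸ W)) → M →ₗ[k] Module.Dual k (MvPolynomial (Fin n) k) :=
      fun j => Φ.compr₂ (LinearMap.proj j ∘ₗ e.toLinearMap)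
    have hΘ : ∀ j m, Θ j m ∈ LinearMap.range (gev (n := n) (Rdeg k n) hR) := by
      intro j m
      obtain ⟨d, hd⟩ := hΦbdd m
      refine exists_gev_eq_of_vanishesAbove hR (d := d) fun c hc g hg => ?_
      change e (Φ m g) j = 0
      rw [hd c hc g hg, map_zero]
      rfl
    let φ : M →ₗ[k] (Fin (Module.finrank k (M ⧸ W)) → Ecar k n) :=
      LinearMap.pi fun j => G.symm.toLinearMap ∘ₗ (Θ j).codRestrict _ (hΘ j)
    have hφ : ∀ m j g, gev (Rdeg k n) hR (φ m j) g = e (Φ m g) j := by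
      intro m j g
      have h : G (φ m j) = ⟨Θ j m, hΘ j m⟩ := G.apply_symm_apply _
      exact congrArg (fun f => f.1 g) h
    refine ⟨φ, fun y => ?_, fun f m j => ?_, fun i m j => ?_⟩
    · choose d hd using fun j => exists_vanishesAbove_gev hR (y j)
      obtain ⟨m, hm⟩ := hΦsurj (Finset.univ.sup d)
        (e.symm.toLinearMap ∘ₗ LinearMap.pi fun j => gev (Rdeg k n) hR (y j)) (by
          intro c hc g hg
          have h0 : (LinearMap.pi fun j => gev (Rdeg k n) hR (y j)) g = 0 := funext fun j =>
            hd j c ((Finset.le_sup (Finset.mem_univ j)).trans_lt hc) g hg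
          rw [LinearMap.comp_apply, h0, map_zero])
      refine ⟨m, funext fun j => gev_injective hR (LinearMap.ext fun g => ?_)⟩
      rw [hφ, hm, LinearMap.comp_apply, LinearEquiv.coe_coe, e.apply_symm_apply]
      rfl
    · refine gev_injective hR (LinearMap.ext fun g => ?_)
      rw [hρE, hφ, hφ, hΦ, hΦ, smul_smul, mul_comm]
    · refine gev_injective hR (LinearMap.ext fun g => ?_)
      rw [hEpd, hφ, hφ, hΦD, map_neg]
      rfl
  · rintro s ⟨φ, hsurj, -, hφD⟩
    let ψ : M →ₗ[k] (Fin s → k) :=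
      LinearMap.pi fun j => LinearMap.applyₗ 1 ∘ₗ gev (Rdeg k n) hR ∘ₗ LinearMap.proj j ∘ₗ φ
    have hψ : ∀ m j, ψ m j = gev (Rdeg k n) hR (φ m j) 1 := fun _ _ => rfl
    have hker : W ≤ LinearMap.ker ψ := by
      refine iSup_le fun i => ?_
      rintro _ ⟨m, rfl⟩
      refine LinearMap.mem_ker.mpr (funext fun j => ?_)
      rw [hψ, hφD, hEpd]
      simp
    have hconst : VanishesAbove 0 (lcoeff k 0 : Module.Dual k (MvPolynomial (Fin n) k)) := by
      intro c hc g hg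
      exact hg.coeff_eq_zero (by simpa using hc.ne)
    obtain ⟨η, hη⟩ := exists_gev_eq_of_vanishesAbove hR hconst
    have hψsurj : Function.Surjective ψ := by
      intro v
      obtain ⟨m, hm⟩ := hsurj fun j => v j • η
      refine ⟨m, funext fun j => ?_⟩
      rw [hψ, hm, map_smul, LinearMap.smul_apply, hη]
      simp
    have hle := LinearMap.finrank_le_finrank_of_surjective (f := W.liftQ ψ hker) (fun v => by
      obtain ⟨m, rfl⟩ := hψsurj v
      exact ⟨W.mkQ m, rfl⟩)
    simpa using hle
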